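/- Let A > 0, let c : ℝ → ℝ² be a smooth 2π-periodic immersion, and let a : ℝ → ℝ be smooth and 2π-periodic. Then ∫ |a| ds ≤ ℓ(c)² · (∫ (ℓ(c)^{−3} + A κ_c²/ℓ(c)) a² ds)^{1/2}. (So in the scale invariant metric G^{SI}, the area swept out by a horizontal path of G^{SI}-length K starting from a curve of length ℓ(0) is at most e^{K/√A} ℓ(0)² K.) -/

import Mathlib

open Real MeasureTheory

/-- Euclidean inner product on ℝ² ≅ ℂ. -/
noncomputable def dot (x y : ℂ) : ℝ := x.re * y.re + x.im * y.im

/-- Curvature κ_c = ⟨Jc', c''⟩ / |c'|³. -/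
noncomputable def curvature (c : ℝ → ℂ) (θ : ℝ) : ℝ :=
  dot (Complex.I * deriv c θ) (deriv (deriv c) θ) / ‖deriv c θ‖ ^ 3

/-- Length ℓ(c) = ∫₀^{2π} |c'(θ)| dθ. -/
noncomputable def len (c : ℝ → ℂ) : ℝ := ∫ θ in (0:ℝ)..2 * π, ‖deriv c θ‖

/-- ∫ |a| ds ≤ ℓ(c)² (∫ (ℓ(c)^{−3} + A κ_c²/ℓ(c)) a² ds)^{1/2}, bounding the
rate of area swept out by a horizontal path in terms of its G^{SI}-speed. -/
theorem stmt11 (A : ℝ) (hA : 0 < A)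
    (c : ℝ → ℂ) (hc : ContDiff ℝ (⊤ : ℕ∞) c) (hcper : ∀ θ, c (θ + 2 * π) = c θ)
    (hcimm : ∀ θ, deriv c θ ≠ 0)
    (a : ℝ → ℝ) (ha : ContDiff ℝ (⊤ : ℕ∞) a) (haper : ∀ θ, a (θ + 2 * π) = a θ) :
    (∫ θ in (0:ℝ)..2 * π, |a θ| * ‖deriv c θ‖)
      ≤ len c ^ 2 * Real.sqrt (∫ θ in (0:ℝ)..2 * π,
          ((len c ^ 3)⁻¹ + A * curvature c θ ^ 2 / len c) * a θ ^ 2 * ‖deriv c θ‖) := by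
  have hd : Continuous (deriv c) := hc.continuous_deriv (by simp)
  have hc' : ContDiff ℝ (⊤ : ℕ∞) (deriv c) := by
    have h := (contDiff_infty_iff_deriv (𝕜 := ℝ) (f := c)).1 hc
    exact h.2
  have hdd : Continuous (deriv (deriv c)) := hc'.continuous_deriv (by simp)
  have hac : Continuous a := ha.continuous
  have hv : Continuous (fun θ => ‖deriv c θ‖) := hd.norm
  have hk : Continuous (curvature c) := by
    unfold curvature dot
    refine Continuous.div ?_ (hv.pow 3) (fun θ => pow_ne_zero _ (norm_ne_zero_iff.2 (hcimm θ)))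
    exact ((Complex.continuous_re.comp (continuous_const.mul hd)).mul
      (Complex.continuous_re.comp hdd)).add
      ((Complex.continuous_im.comp (continuous_const.mul hd)).mul
      (Complex.continuous_im.comp hdd))
  have hpi : (0:ℝ) < 2 * π := by positivity
  have hL : 0 < len c := by
    unfold len
    exact intervalIntegral.intervalIntegral_pos_of_pos (hv.intervalIntegrable _ _)
      (fun θ => norm_pos_iff.2 (hcimm θ)) hpi
  have hLdef : (∫ θ in (0:ℝ)..2 * π, ‖deriv c θ‖) = len c := rfl
  generalize len c = L at hL hLdef ⊢
  set I := ∫ θ in (0:ℝ)..2 * π, |a θ| * ‖deriv c θ‖ with hI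
  have hav : Continuous (fun θ => |a θ| * ‖deriv c θ‖) := hac.abs.mul hv
  have hsv : Continuous (fun θ => a θ ^ 2 * ‖deriv c θ‖) := (hac.pow 2).mul hv
  have hCS : I ^ 2 / L ≤ ∫ θ in (0:ℝ)..2 * π, a θ ^ 2 * ‖deriv c θ‖ := by
    have h1 : (∫ θ in (0:ℝ)..2 * π,
        (2 * (I / L) * (|a θ| * ‖deriv c θ‖) - (I / L) ^ 2 * ‖deriv c θ‖)) = I ^ 2 / L := by
      rw [intervalIntegral.integral_sub ((hav.const_mul _).intervalIntegrable _ _)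
        ((hv.const_mul _).intervalIntegrable _ _),
        intervalIntegral.integral_const_mul, intervalIntegral.integral_const_mul, hLdef, ← hI]
      field_simp
      ring
    rw [← h1]
    refine intervalIntegral.integral_mono_on hpi.le
      (((hav.const_mul _).sub (hv.const_mul _)).intervalIntegrable _ _)
      (hsv.intervalIntegrable _ _) (fun θ _ => ?_)
    have h2 := mul_nonneg (sq_nonneg (|a θ| - I / L)) (norm_nonneg (deriv c θ))
    have h3 := sq_abs (a θ)
    rw [← h3]
    nlinarith
  have hQ : (L ^ 3)⁻¹ * (I ^ 2 / L) ≤ ∫ θ in (0:ℝ)..2 * π,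
      ((L ^ 3)⁻¹ + A * curvature c θ ^ 2 / L) * a θ ^ 2 * ‖deriv c θ‖ := by
    refine (mul_le_mul_of_nonneg_left hCS (by positivity)).trans ?_
    rw [← intervalIntegral.integral_const_mul]
    refine intervalIntegral.integral_mono_on hpi.le ((hsv.const_mul _).intervalIntegrable _ _)
      (Continuous.intervalIntegrable ?_ _ _) (fun θ _ => ?_)
    · exact ((continuous_const.add (((hk.pow 2).const_mul A).div_const L)).mul (hac.pow 2)).mul hv
    · rw [mul_assoc]
      refine mul_le_mul_of_nonneg_right ?_ (by positivity)
      have : 0 ≤ A * curvature c θ ^ 2 / L := by positivity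
      linarith
  have h4 : I / L ^ 2 ≤ Real.sqrt (∫ θ in (0:ℝ)..2 * π,
      ((L ^ 3)⁻¹ + A * curvature c θ ^ 2 / L) * a θ ^ 2 * ‖deriv c θ‖) := by
    apply Real.le_sqrt_of_sq_le
    refine le_trans (le_of_eq ?_) hQ
    field_simp
  rw [div_le_iff₀ (by positivity)] at h4
  linarith
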